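/- Assume the sequence R_1, …, R_m is disjoint-superset and d_i ≥ 1 for every i. Let 1 ≤ j ≤ i ≤ m and let c, c' ∈ R_j be coins with Pr_i(c) > 0 and Pr_i(c') > 0. If Pr_i(r_j | c) ≤ Pr_i(r_j | c'), then for every k with j−1 ≤ k ≤ i: Pr_k(c) ≥ Pr_k(c'). -/

import Mathlib

open scoped Classical

/-- The spent coin permutations for the first `k` ring signatures of the
sequence `R` (rings are indexed from `1`): injective functions `σ : Fin k → C`
with `σ(j) ∈ R_j` for each `j ∈ {1, …, k}` (position `j` of `σ` is `j - 1`). -/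
noncomputable def perms {C : Type*} [Fintype C] [DecidableEq C]
    (R : ℕ → Finset C) (k : ℕ) : Finset (Fin k → C) :=
  Finset.univ.filter fun σ => Function.Injective σ ∧ ∀ j : Fin k, σ j ∈ R (j.1 + 1)

/-- `N_k`, the number of spent coin permutations for the first `k` ring signatures. -/
noncomputable def numPerms {C : Type*} [Fintype C] [DecidableEq C]
    (R : ℕ → Finset C) (k : ℕ) : ℕ :=
  (perms R k).card

/-- `Pr_k(c, r_j)`: the fraction of spent coin permutations `σ` for the first `k`
ring signatures with `σ(j) = c`. -/
noncomputable def prSpentIn {C : Type*} [Fintype C] [DecidableEq C]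
    (R : ℕ → Finset C) (k j : ℕ) (c : C) : ℝ :=
  (((perms R k).filter fun σ => ∃ h : j - 1 < k, σ ⟨j - 1, h⟩ = c).card : ℝ) /
    (numPerms R k : ℝ)

/-- `Pr_k(c)`: the fraction of spent coin permutations `σ` for the first `k`
ring signatures having `c` in their image. -/
noncomputable def prSpent {C : Type*} [Fintype C] [DecidableEq C]
    (R : ℕ → Finset C) (k : ℕ) (c : C) : ℝ :=
  (((perms R k).filter fun σ => ∃ j, σ j = c).card : ℝ) / (numPerms R k : ℝ)

/-- `Pr_k(r_j | c) = Pr_k(c, r_j) / Pr_k(c)`. -/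
noncomputable def prCond {C : Type*} [Fintype C] [DecidableEq C]
    (R : ℕ → Finset C) (k j : ℕ) (c : C) : ℝ :=
  prSpentIn R k j c / prSpent R k c

/-- The first `m` ring signatures of `R` are disjoint-superset: for all
`1 ≤ j < i ≤ m`, either `R_i ∩ R_j = ∅` or `R_j ⊆ R_i`. -/
def DisjointSuperset {C : Type*} [Fintype C] [DecidableEq C]
    (R : ℕ → Finset C) (m : ℕ) : Prop :=
  ∀ i j, 1 ≤ j → j < i → i ≤ m → Disjoint (R i) (R j) ∨ R j ⊆ R i

/-- `ns_i`: the number of indices `j < i` with `R_j ⊆ R_i`. -/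
noncomputable def nsub {C : Type*} [Fintype C] [DecidableEq C]
    (R : ℕ → Finset C) (i : ℕ) : ℕ :=
  ((Finset.Ico 1 i).filter fun j => R j ⊆ R i).card

/-- The degree `d_i = |R_i| - ns_i`. -/
noncomputable def deg {C : Type*} [Fintype C] [DecidableEq C]
    (R : ℕ → Finset C) (i : ℕ) : ℕ :=
  (R i).card - nsub R i

/-- The spent coin permutations for the first `k + 1` rings satisfying `P`, counted by their
restriction to the first `k` rings and their last coin. -/
theorem card_filter_perms_succ {C : Type*} [Fintype C] [DecidableEq C]
    (R : ℕ → Finset C) (k : ℕ) (P : (Fin (k + 1) → C) → Prop)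
    [DecidablePred P] :
    ((perms R (k + 1)).filter P).card =
      ∑ σ ∈ perms R k,
        ((R (k + 1) \ Finset.univ.image σ).filter fun x => P (Fin.snoc σ x)).card := by
  rw [← Finset.card_sigma]
  refine Finset.card_bij' (fun τ _ => ⟨Fin.init τ, τ (Fin.last k)⟩)
    (fun p _ => Fin.snoc p.1 p.2) ?_ ?_ ?_ ?_
  · intro τ hτ
    simp only [perms, Finset.mem_filter, Finset.mem_univ, true_and] at hτ
    obtain ⟨⟨hinj, hmem⟩, hP⟩ := hτ
    simp only [perms, Finset.mem_sigma, Finset.mem_filter, Finset.mem_univ, true_and,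
      Finset.mem_sdiff, Finset.mem_image, Fin.snoc_init_self, not_exists]
    refine ⟨⟨fun a b hab => Fin.castSucc_injective _ (hinj hab), fun a => hmem a.castSucc⟩,
      ⟨by simpa using hmem (Fin.last k), fun a ha => ?_⟩, hP⟩
    exact (Fin.castSucc_lt_last a).ne (hinj ha)
  · rintro ⟨σ, x⟩ h
    simp only [perms, Finset.mem_sigma, Finset.mem_filter, Finset.mem_univ, true_and,
      Finset.mem_sdiff, Finset.mem_image, not_exists] at h
    obtain ⟨⟨hinj, hmem⟩, ⟨hx, hxσ⟩, hP⟩ := h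
    simp only [perms, Finset.mem_filter, Finset.mem_univ, true_and]
    refine ⟨⟨Fin.snoc_injective_iff.2 ⟨hinj, fun ⟨a, ha⟩ => hxσ a ha⟩, ?_⟩, hP⟩
    intro a
    induction a using Fin.lastCases with
    | last => simpa using hx
    | cast a => simpa using hmem a
  · intro τ _
    exact Fin.snoc_init_self τ
  · rintro ⟨σ, x⟩ _
    simp

/-- However the first `k` coins are spent, ring `k + 1` has `d_{k+1}` unspent coins. -/
theorem card_sdiff_image_eq_deg {C : Type*} [Fintype C] [DecidableEq C]
    {R : ℕ → Finset C} {m k : ℕ} (hds : DisjointSuperset R m) (hk : k + 1 ≤ m)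
    {σ : Fin k → C} (hσ : σ ∈ perms R k) :
    (R (k + 1) \ Finset.univ.image σ).card = deg R (k + 1) := by
  simp only [perms, Finset.mem_filter, Finset.mem_univ, true_and] at hσ
  obtain ⟨hinj, hmem⟩ := hσ
  rw [Finset.card_sdiff, deg, nsub]
  congr 1
  have himage : Finset.univ.image σ ∩ R (k + 1) =
      (Finset.univ.filter fun a : Fin k => R (a.1 + 1) ⊆ R (k + 1)).image σ := by
    ext x
    simp only [Finset.mem_inter, Finset.mem_image, Finset.mem_univ, true_and, Finset.mem_filter]
    constructor
    · rintro ⟨⟨a, rfl⟩, hx⟩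
      refine ⟨a, (hds (k + 1) (a.1 + 1) (by omega) (by omega) hk).resolve_left fun h => ?_, rfl⟩
      exact Finset.disjoint_left.1 h hx (hmem a)
    · rintro ⟨a, ha, rfl⟩
      exact ⟨⟨a, rfl⟩, ha (hmem a)⟩
  rw [himage, Finset.card_image_of_injective _ hinj]
  refine Finset.card_bij (fun a _ => a.1 + 1) ?_ ?_ ?_
  · intro a ha
    simp only [Finset.mem_filter, Finset.mem_univ, true_and, Finset.mem_Ico] at ha ⊢
    exact ⟨by omega, ha⟩
  · intro a _ b _ h
    exact Fin.ext (by omega)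
  · intro b hb
    simp only [Finset.mem_filter, Finset.mem_Ico] at hb
    refine ⟨⟨b - 1, by omega⟩, ?_, by simp only; omega⟩
    simp only [Finset.mem_filter, Finset.mem_univ, true_and]
    rw [Nat.sub_add_cancel hb.1.1]
    exact hb.2

theorem numPerms_succ {C : Type*} [Fintype C] [DecidableEq C]
    {R : ℕ → Finset C} {m k : ℕ} (hds : DisjointSuperset R m) (hk : k + 1 ≤ m) :
    numPerms R (k + 1) = numPerms R k * deg R (k + 1) := by
  have h := card_filter_perms_succ R k fun _ => True
  simp only [Finset.filter_true] at h
  rw [numPerms, h, numPerms, Finset.sum_congr rfl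
    fun σ hσ => card_sdiff_image_eq_deg hds hk hσ, Finset.sum_const, smul_eq_mul]

theorem numPerms_pos {C : Type*} [Fintype C] [DecidableEq C]
    {R : ℕ → Finset C} {m : ℕ} (hds : DisjointSuperset R m)
    (hdeg : ∀ i, 1 ≤ i → i ≤ m → 1 ≤ deg R i) {k : ℕ} (hk : k ≤ m) : 0 < numPerms R k := by
  induction k with
  | zero =>
    refine Finset.card_pos.2 ⟨default, ?_⟩
    simp [perms, Function.Injective]
  | succ k ih =>
    rw [numPerms_succ hds hk]
    exact Nat.mul_pos (ih (by omega)) (hdeg _ (by omega) hk)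

/-- The number of spent coin permutations for the first `k` ring signatures in which ring `j`
spends `c`. -/
noncomputable def numSpentIn {C : Type*} [Fintype C] [DecidableEq C]
    (R : ℕ → Finset C) (k j : ℕ) (c : C) : ℕ :=
  ((perms R k).filter fun σ => ∃ h : j - 1 < k, σ ⟨j - 1, h⟩ = c).card

/-- The number of spent coin permutations for the first `k` ring signatures leaving `c`
unspent. -/
noncomputable def numUnspent {C : Type*} [Fintype C] [DecidableEq C]
    (R : ℕ → Finset C) (k : ℕ) (c : C) : ℕ :=
  ((perms R k).filter fun σ => ¬ ∃ j, σ j = c).card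

theorem numUnspent_succ {C : Type*} [Fintype C] [DecidableEq C]
    {R : ℕ → Finset C} {m k : ℕ} (hds : DisjointSuperset R m) (hk : k + 1 ≤ m) (c : C) :
    numUnspent R (k + 1) c =
      numUnspent R k c * (deg R (k + 1) - if c ∈ R (k + 1) then 1 else 0) := by
  rw [numUnspent, card_filter_perms_succ, numUnspent, ← smul_eq_mul, ← Finset.sum_const,
    Finset.sum_filter]
  refine Finset.sum_congr rfl fun σ hσ => ?_
  rw [← card_sdiff_image_eq_deg hds hk hσ]
  have hsnoc : ∀ x, (∃ a, (Fin.snoc σ x : Fin (k + 1) → C) a = c) ↔ (∃ a, σ a = c) ∨ x = c := by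
    intro x
    simp [Fin.exists_fin_succ']
  simp only [hsnoc]
  by_cases hc : ∃ a, σ a = c
  · simp [hc]
  · simp only [hc, false_or, not_false_eq_true, if_true]
    rw [Finset.filter_ne']
    rw [Finset.card_erase_eq_ite]
    have : c ∈ R (k + 1) \ Finset.univ.image σ ↔ c ∈ R (k + 1) := by
      simpa using fun _ a ha => hc ⟨a, ha⟩
    simp only [this]
    split_ifs <;> rfl

theorem numSpentIn_self {C : Type*} [Fintype C] [DecidableEq C]
    {R : ℕ → Finset C} {k : ℕ} {c : C} (hc : c ∈ R (k + 1)) :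
    numSpentIn R (k + 1) (k + 1) c = numUnspent R k c := by
  rw [numSpentIn, card_filter_perms_succ, numUnspent, Finset.card_filter]
  refine Finset.sum_congr rfl fun σ _ => ?_
  have hlast : ∀ x, (∃ h : k + 1 - 1 < k + 1,
      (Fin.snoc σ x : Fin (k + 1) → C) ⟨k + 1 - 1, h⟩ = c) ↔ x = c := by
    intro x
    have : (Fin.snoc σ x : Fin (k + 1) → C) ⟨k, k.lt_succ_self⟩ = x :=
      Fin.snoc_last (α := fun _ => C) x σ
    simp [this]
  simp only [hlast]
  rw [Finset.filter_eq']
  by_cases h : ∃ a, σ a = c <;> simp [h, hc]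

theorem numSpentIn_succ {C : Type*} [Fintype C] [DecidableEq C]
    {R : ℕ → Finset C} {m k j : ℕ} (hds : DisjointSuperset R m) (hk : k + 1 ≤ m)
    (hj : j - 1 < k) (c : C) :
    numSpentIn R (k + 1) j c = numSpentIn R k j c * deg R (k + 1) := by
  rw [numSpentIn, card_filter_perms_succ, numSpentIn, ← smul_eq_mul, ← Finset.sum_const,
    Finset.sum_filter]
  refine Finset.sum_congr rfl fun σ hσ => ?_
  rw [← card_sdiff_image_eq_deg hds hk hσ]
  have hcast : ∀ x, (∃ h : j - 1 < k + 1,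
      (Fin.snoc σ x : Fin (k + 1) → C) ⟨j - 1, h⟩ = c) ↔ ∃ h : j - 1 < k, σ ⟨j - 1, h⟩ = c := by
    intro x
    have : (Fin.snoc σ x : Fin (k + 1) → C) ⟨j - 1, by omega⟩ = σ ⟨j - 1, hj⟩ :=
      Fin.snoc_castSucc (α := fun _ => C) x σ ⟨j - 1, hj⟩
    simp [this, hj, Nat.lt_succ_of_lt hj]
  simp only [hcast]
  by_cases h : ∃ h : j - 1 < k, σ ⟨j - 1, h⟩ = c <;> simp [h]

theorem mem_iff_mem_of_mem_ring {C : Type*} [Fintype C] [DecidableEq C]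
    {R : ℕ → Finset C} {m j k : ℕ} (hds : DisjointSuperset R m) (hj : 1 ≤ j) (hjk : j ≤ k)
    (hk : k ≤ m) {c c' : C} (hc : c ∈ R j) (hc' : c' ∈ R j) : c ∈ R k ↔ c' ∈ R k := by
  rcases hjk.eq_or_lt with rfl | hlt
  · exact iff_of_true hc hc'
  · rcases hds k j hj hlt hk with h | h
    · exact iff_of_false (Finset.disjoint_right.1 h hc) (Finset.disjoint_right.1 h hc')
    · exact iff_of_true (h hc) (h hc')

/-- From ring `j = n + 1` on, the number of permutations leaving a coin of `R_j` unspent evolves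
by a factor that does not depend on the coin. -/
theorem exists_numUnspent_eq_mul {C : Type*} [Fintype C] [DecidableEq C]
    {R : ℕ → Finset C} {m n k : ℕ} (hds : DisjointSuperset R m) (hnk : n ≤ k) (hk : k ≤ m)
    {c c' : C} (hc : c ∈ R (n + 1)) (hc' : c' ∈ R (n + 1)) :
    ∃ a : ℕ, numUnspent R k c = numUnspent R n c * a ∧
      numUnspent R k c' = numUnspent R n c' * a := by
  induction k, hnk using Nat.le_induction with
  | base => exact ⟨1, by simp, by simp⟩
  | succ k hnk ih =>
    obtain ⟨a, ha, ha'⟩ := ih (by omega)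
    have hiff := mem_iff_mem_of_mem_ring hds (by omega) (by omega : n + 1 ≤ k + 1) hk hc hc'
    refine ⟨a * (deg R (k + 1) - if c ∈ R (k + 1) then 1 else 0), ?_, ?_⟩
    · rw [numUnspent_succ hds hk, ha, mul_assoc]
    · rw [numUnspent_succ hds hk, ha', mul_assoc]
      simp only [hiff]

theorem exists_numSpentIn_eq_mul {C : Type*} [Fintype C] [DecidableEq C]
    {R : ℕ → Finset C} {m n k : ℕ} (hds : DisjointSuperset R m)
    (hdeg : ∀ i, 1 ≤ i → i ≤ m → 1 ≤ deg R i) (hnk : n + 1 ≤ k) (hk : k ≤ m) :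
    ∃ b : ℕ, 0 < b ∧ ∀ c ∈ R (n + 1), numSpentIn R k (n + 1) c = numUnspent R n c * b := by
  induction k, hnk using Nat.le_induction with
  | base => exact ⟨1, one_pos, fun c hc => by rw [numSpentIn_self hc, mul_one]⟩
  | succ k hnk ih =>
    obtain ⟨b, hb, h⟩ := ih (by omega)
    refine ⟨b * deg R (k + 1), Nat.mul_pos hb (hdeg _ (by omega) hk), fun c hc => ?_⟩
    rw [numSpentIn_succ hds hk (by omega), h c hc, mul_assoc]

theorem prSpent_eq {C : Type*} [Fintype C] [DecidableEq C]
    (R : ℕ → Finset C) (k : ℕ) (c : C) :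
    prSpent R k c = ((numPerms R k : ℝ) - numUnspent R k c) / numPerms R k := by
  have h : ((perms R k).filter fun σ => ∃ j, σ j = c).card + numUnspent R k c = numPerms R k :=
    Finset.card_filter_add_card_filter_not (s := perms R k) fun σ => ∃ j, σ j = c
  rw [prSpent, ← h]
  push_cast
  rw [add_sub_cancel_right]

theorem stmt5 {C : Type*} [Fintype C] [DecidableEq C]
    (R : ℕ → Finset C) (m : ℕ)
    (hne : ∀ i, 1 ≤ i → i ≤ m → (R i).Nonempty)
    (hds : DisjointSuperset R m)
    (hdeg : ∀ i, 1 ≤ i → i ≤ m → 1 ≤ deg R i)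
    (i j : ℕ) (hj : 1 ≤ j) (hji : j ≤ i) (him : i ≤ m)
    (c c' : C) (hc : c ∈ R j) (hc' : c' ∈ R j)
    (hpc : 0 < prSpent R i c) (hpc' : 0 < prSpent R i c')
    (hcond : prCond R i j c ≤ prCond R i j c') :
    ∀ k, j - 1 ≤ k → k ≤ i → prSpent R k c' ≤ prSpent R k c := by
  obtain ⟨n, rfl⟩ : ∃ n, j = n + 1 := ⟨j - 1, by omega⟩
  have hle : (numUnspent R n c : ℝ) ≤ numUnspent R n c' := by
    have hN : (0 : ℝ) < numPerms R i := by exact_mod_cast numPerms_pos hds hdeg him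
    obtain ⟨a, ha, ha'⟩ := exists_numUnspent_eq_mul hds (by omega : n ≤ i) him hc hc'
    obtain ⟨b, hb, hspent⟩ := exists_numSpentIn_eq_mul hds hdeg hji him
    have hpr : ∀ x ∈ R (n + 1),
        prSpentIn R i (n + 1) x = (numUnspent R n x : ℝ) * b / numPerms R i := by
      intro x hx
      rw [← Nat.cast_mul, ← hspent x hx]
      rfl
    rw [prSpent_eq, ha, div_pos_iff_of_pos_right hN] at hpc
    rw [prSpent_eq, ha', div_pos_iff_of_pos_right hN] at hpc'
    rw [prCond, prCond, hpr c hc, hpr c' hc', prSpent_eq, prSpent_eq, ha, ha',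
      div_div_div_cancel_right₀ hN.ne', div_div_div_cancel_right₀ hN.ne',
      div_le_div_iff₀ hpc hpc'] at hcond
    push_cast at hcond
    have hb' : (0 : ℝ) < b := by exact_mod_cast hb
    refine le_of_mul_le_mul_right ?_ (mul_pos hb' hN)
    linarith
  intro k hk hki
  obtain ⟨a, ha, ha'⟩ := exists_numUnspent_eq_mul hds (by omega : n ≤ k) (by omega) hc hc'
  rw [prSpent_eq, prSpent_eq, ha, ha']
  push_cast
  gcongr
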